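/- For all 0 ≤ b ≤ a, every finite multiset of positive real numbers whose sum is at most a and whose every element is at least b can be packed into a right isosceles (a, b)-hat. (Right isosceles (a,b)-hats are 𝔺(a,b)-shapes.) -/

import Mathlib

noncomputable section

abbrev Plane := EuclideanSpace ℝ (Fin 2)

def pt (x y : ℝ) : Plane := (WithLp.equiv 2 (Fin 2 → ℝ)).symm ![x, y]

/-- A finite multiset of positive reals `C`, interpreted as circle areas, can be packed
into `S ⊆ ℝ²`: each area `a` gets a center such that the closed disk of radius `√(a/π)`
lies in `S`, and the open disks are pairwise disjoint. -/
def Packs (C : Multiset ℝ) (S : Set Plane) : Prop :=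
  ∃ l : List (ℝ × Plane),
    (↑(l.map Prod.fst) : Multiset ℝ) = C ∧
    (∀ p ∈ l, Metric.closedBall p.2 (Real.sqrt (p.1 / Real.pi)) ⊆ S) ∧
    l.Pairwise fun p q =>
      Disjoint (Metric.ball p.2 (Real.sqrt (p.1 / Real.pi)))
               (Metric.ball q.2 (Real.sqrt (q.1 / Real.pi)))

/-- The union of all closed disks of radius `s` contained in `T`
(`T` with its corners rounded to radius `s`). -/
def roundCorners (s : ℝ) (T : Set Plane) : Set Plane :=
  ⋃ c ∈ {c : Plane | Metric.closedBall c s ⊆ T}, Metric.closedBall c s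

/-- A closed isosceles right triangle whose incircle has area `a`:
right angle at the origin, legs of length `(2+√2)·√(a/π)` along the axes. -/
def rightIsoTriangle (a : ℝ) : Set Plane :=
  convexHull ℝ {pt 0 0, pt ((2 + Real.sqrt 2) * Real.sqrt (a / Real.pi)) 0,
    pt 0 ((2 + Real.sqrt 2) * Real.sqrt (a / Real.pi))}

/-- The right isosceles `(a,b)`-hat. -/
def rightIsoHat (a b : ℝ) : Set Plane :=
  roundCorners (Real.sqrt (b / Real.pi)) (rightIsoTriangle a)

/-- The center inequalities saying that the disk of radius `t` about `p` lies in the right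
isosceles triangle with legs of length `ℓ` along the axes. -/
def DiskInTriangle (ℓ t : ℝ) (p : Plane) : Prop :=
  t ≤ p 0 ∧ t ≤ p 1 ∧ p 0 + p 1 ≤ ℓ - √2 * t

lemma plane_dist_eq (p q : Plane) :
    dist p q = √((p 0 - q 0) ^ 2 + (p 1 - q 1) ^ 2) := by
  simp [EuclideanSpace.dist_eq, Fin.sum_univ_two, Real.dist_eq, sq_abs]

lemma pt_zero (x y : ℝ) : pt x y 0 = x := by simp [pt]

lemma pt_one (x y : ℝ) : pt x y 1 = y := by simp [pt]

lemma mem_convexHull_of_coords {ℓ : ℝ} {p : Plane} (h0 : 0 ≤ p 0) (h1 : 0 ≤ p 1)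
    (h : p 0 + p 1 ≤ ℓ) : p ∈ convexHull ℝ {pt 0 0, pt ℓ 0, pt 0 ℓ} := by
  rcases (by linarith : 0 ≤ ℓ).eq_or_lt with rfl | hℓ
  · apply subset_convexHull
    left
    ext i
    fin_cases i
    · simp only [Fin.zero_eta, pt_zero]; linarith
    · simp only [Fin.mk_one, pt_one]; linarith
  · have hw : 0 ≤ 1 - (p 0 + p 1) / ℓ := by
      rw [sub_nonneg, div_le_one hℓ]; exact h
    have hp := (convex_convexHull ℝ {pt 0 0, pt ℓ 0, pt 0 ℓ}).sum_mem (t := Finset.univ)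
      (w := ![1 - (p 0 + p 1) / ℓ, p 0 / ℓ, p 1 / ℓ]) (z := ![pt 0 0, pt ℓ 0, pt 0 ℓ])
      (by
        intro i _
        fin_cases i
        · exact hw
        · exact div_nonneg h0 hℓ.le
        · exact div_nonneg h1 hℓ.le)
      (by simp [Fin.sum_univ_three]; ring)
      (by
        intro i _
        apply subset_convexHull
        fin_cases i <;> simp)
    convert hp using 1
    ext i
    fin_cases i
    · simp [Fin.sum_univ_three, pt_zero, hℓ.ne']
    · simp [Fin.sum_univ_three, pt_one, hℓ.ne']

lemma DiskInTriangle.closedBall_subset {ℓ t : ℝ} {p : Plane} (h : DiskInTriangle ℓ t p) :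
    Metric.closedBall p t ⊆ convexHull ℝ {pt 0 0, pt ℓ 0, pt 0 ℓ} := by
  intro q hq
  have ht : 0 ≤ t := dist_nonneg.trans (Metric.mem_closedBall.1 hq)
  obtain ⟨h0, h1, h2⟩ := h
  rw [Metric.mem_closedBall, plane_dist_eq, Real.sqrt_le_left ht] at hq
  have a0 := abs_le_of_sq_le_sq' (by nlinarith [sq_nonneg (q 1 - p 1)] :
    (q 0 - p 0) ^ 2 ≤ t ^ 2) ht
  have a1 := abs_le_of_sq_le_sq' (by nlinarith [sq_nonneg (q 0 - p 0)] :
    (q 1 - p 1) ^ 2 ≤ t ^ 2) ht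
  have a2 := abs_le_of_sq_le_sq' (by
      rw [mul_pow, Real.sq_sqrt zero_le_two]
      nlinarith [sq_nonneg ((q 0 - p 0) - (q 1 - p 1))] :
    ((q 0 - p 0) + (q 1 - p 1)) ^ 2 ≤ (√2 * t) ^ 2) (by positivity)
  exact mem_convexHull_of_coords (by linarith) (by linarith) (by linarith)

lemma closedBall_subset_roundCorners {s t : ℝ} {c : Plane} {T : Set Plane} (hs : 0 ≤ s)
    (hst : s ≤ t) (h : Metric.closedBall c t ⊆ T) :
    Metric.closedBall c t ⊆ roundCorners s T := by
  intro z hz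
  rw [Metric.mem_closedBall] at hz
  obtain ⟨w, hzw, hwc⟩ := exists_dist_le_le hs (sub_nonneg.2 hst)
    (show dist z c ≤ t - s + s by linarith)
  refine Set.mem_biUnion (x := w) (fun y hy => h ?_) hzw
  rw [Metric.mem_closedBall] at hy ⊢
  linarith [dist_triangle y w c]

/-- Every multiset of positive reals is the sum of two parts such that no element is smaller than
the excess of its part over the other. -/
lemma exists_balanced_split (C : Multiset ℝ) (hpos : ∀ c ∈ C, 0 < c) :
    ∃ A B : Multiset ℝ, A + B = C ∧ (∀ c ∈ A, A.sum - B.sum ≤ c) ∧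
      ∀ c ∈ B, B.sum - A.sum ≤ c := by
  obtain ⟨⟨A, B⟩, hAB, hmin⟩ := C.antidiagonal.toFinset.exists_min_image
    (fun D => |D.1.sum - D.2.sum|) ⟨(0, C), by simp⟩
  simp only [Multiset.mem_toFinset, Multiset.mem_antidiagonal, Prod.forall] at hAB hmin
  subst hAB
  refine ⟨A, B, rfl, fun c hc => ?_, fun c hc => ?_⟩
  · by_contra! hlt
    have hc0 := hpos c (Multiset.mem_add.2 (Or.inl hc))
    obtain ⟨A', rfl⟩ := Multiset.exists_cons_of_mem hc
    have := hmin A' (c ::ₘ B) (by simp)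
    simp only [Multiset.sum_cons] at this hlt
    rw [abs_of_pos (by linarith : 0 < c + A'.sum - B.sum)] at this
    rcases le_abs'.1 this with h | h <;> linarith
  · by_contra! hlt
    have hc0 := hpos c (Multiset.mem_add.2 (Or.inr hc))
    obtain ⟨B', rfl⟩ := Multiset.exists_cons_of_mem hc
    have := hmin (c ::ₘ A) B' (by simp)
    simp only [Multiset.sum_cons] at this hlt
    rw [abs_of_neg (by linarith : A.sum - (c + B'.sum) < 0)] at this
    rcases le_abs'.1 this with h | h <;> linarith

/-- The isometry carrying the right isosceles triangle with legs `m` along the axes into the corner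
`(ℓ, 0)` of the one with legs `ℓ`, its right angle going to the hypotenuse. -/
def toRightCorner (ℓ m : ℝ) (p : Plane) : Plane :=
  pt (ℓ + √2 / 2 * (p 0 - p 1 - m)) (√2 / 2 * (m - p 0 - p 1))

/-- The mirror image of `toRightCorner`, into the corner `(0, ℓ)`. -/
def toTopCorner (ℓ m : ℝ) (p : Plane) : Plane :=
  pt (√2 / 2 * (m - p 0 - p 1)) (ℓ + √2 / 2 * (p 0 - p 1 - m))

lemma dist_toRightCorner (ℓ m : ℝ) (p q : Plane) :
    dist (toRightCorner ℓ m p) (toRightCorner ℓ m q) = dist p q := by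
  have h2 : √2 ^ 2 = 2 := Real.sq_sqrt zero_le_two
  simp only [plane_dist_eq, toRightCorner, pt_zero, pt_one]
  congr 1
  linear_combination ((p 0 - q 0) ^ 2 + (p 1 - q 1) ^ 2) / 2 * h2

lemma dist_toTopCorner (ℓ m : ℝ) (p q : Plane) :
    dist (toTopCorner ℓ m p) (toTopCorner ℓ m q) = dist p q := by
  rw [← dist_toRightCorner ℓ m p q]
  simp only [plane_dist_eq, toRightCorner, toTopCorner, pt_zero, pt_one]
  rw [add_comm]

lemma DiskInTriangle.toRightCorner {ℓ m t : ℝ} {p : Plane} (h : DiskInTriangle m t p)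
    (hm : √2 * m ≤ ℓ + √2 * t) : DiskInTriangle ℓ t (toRightCorner ℓ m p) := by
  have h2 : √2 ^ 2 = 2 := Real.sq_sqrt zero_le_two
  have h0 : 0 < √2 := by positivity
  obtain ⟨hu, hv, huv⟩ := h
  simp only [DiskInTriangle, _root_.toRightCorner, pt_zero, pt_one]
  refine ⟨?_, ?_, by linarith [mul_le_mul_of_nonneg_left hv h0.le]⟩
  · have := mul_le_mul_of_nonneg_left
      (show (2 + √2) * t - 2 * m ≤ p 0 - p 1 - m by linarith) (half_pos h0).le
    have e : √2 / 2 * ((2 + √2) * t - 2 * m) = √2 * t + t - √2 * m := by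
      linear_combination t / 2 * h2
    linarith
  · have := mul_le_mul_of_nonneg_left
      (show √2 * t ≤ m - p 0 - p 1 by linarith) (half_pos h0).le
    have e : √2 / 2 * (√2 * t) = t := by linear_combination t / 2 * h2
    linarith

lemma DiskInTriangle.toTopCorner {ℓ m t : ℝ} {p : Plane} (h : DiskInTriangle m t p)
    (hm : √2 * m ≤ ℓ + √2 * t) : DiskInTriangle ℓ t (toTopCorner ℓ m p) := by
  have := h.toRightCorner hm
  simp only [DiskInTriangle, _root_.toRightCorner, _root_.toTopCorner, pt_zero, pt_one] at this ⊢
  exact ⟨this.2.1, this.1, by linarith [this.2.2]⟩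

lemma le_dist_toRightCorner_toTopCorner {ℓ m n t u : ℝ} {p q : Plane} (ht : 0 ≤ t) (hu : 0 ≤ u)
    (hp : DiskInTriangle m t p) (hq : DiskInTriangle n u q) (h : m + n ≤ √2 * ℓ) :
    t + u ≤ dist (toRightCorner ℓ m p) (toTopCorner ℓ n q) := by
  have h2 : √2 ^ 2 = 2 := Real.sq_sqrt zero_le_two
  have h0 : 0 < √2 := by positivity
  simp only [plane_dist_eq, toRightCorner, toTopCorner, pt_zero, pt_one]
  apply Real.le_sqrt_of_sq_le
  set X := ℓ + √2 / 2 * (p 0 - p 1 - m) - √2 / 2 * (n - q 0 - q 1) with hX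
  set Y := √2 / 2 * (m - p 0 - p 1) - (ℓ + √2 / 2 * (q 0 - q 1 - n)) with hY
  have key : √2 * (t + u) ≤ X - Y := by
    have e : X - Y = 2 * ℓ + √2 * (p 0 + q 0 - m - n) := by rw [hX, hY]; ring
    have hl := mul_le_mul_of_nonneg_left h h0.le
    have := mul_le_mul_of_nonneg_left (add_le_add hp.1 hq.1) h0.le
    rw [← mul_assoc, Real.mul_self_sqrt zero_le_two] at hl
    linarith
  have := pow_le_pow_left₀ (by positivity) key 2
  nlinarith [sq_nonneg (X + Y)]

/-- Length of the legs of the right isosceles triangle whose incircle has area `a`. -/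
def legLength (a : ℝ) : ℝ := (2 + √2) * √(a / Real.pi)

lemma legLength_mono {a b : ℝ} (h : a ≤ b) : legLength a ≤ legLength b := by
  unfold legLength
  gcongr

lemma sqrt_two_mul_legLength_le {a b c : ℝ} (ha : 0 ≤ a) (hb : 0 ≤ b) (hc : 0 ≤ c)
    (hca : c ≤ a + b) (h : a - b ≤ c) :
    √2 * legLength a ≤ legLength (a + b) + √2 * √(c / Real.pi) := by
  have h2 : √2 ^ 2 = 2 := Real.sq_sqrt zero_le_two
  have h1 : 1 < √2 := Real.lt_sqrt_of_sq_lt (by norm_num)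
  have hπ := Real.pi_pos
  unfold legLength
  have hr := Real.sq_sqrt (show 0 ≤ (a + b) / Real.pi by positivity)
  have hr1 := Real.sq_sqrt (show 0 ≤ a / Real.pi by positivity)
  have ht := Real.sq_sqrt (show 0 ≤ c / Real.pi by positivity)
  have htr : √(c / Real.pi) ≤ √((a + b) / Real.pi) := by gcongr
  have hq : 2 * (a / Real.pi) ≤ (a + b) / Real.pi + c / Real.pi := by
    rw [← add_div, ← mul_div_assoc]
    gcongr
    linarith
  rw [← hr, ← hr1, ← ht] at hq
  have hr0 := Real.sqrt_nonneg ((a + b) / Real.pi)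
  have ht0 := Real.sqrt_nonneg (c / Real.pi)
  generalize √(a / Real.pi) = x at *
  generalize √((a + b) / Real.pi) = r at *
  generalize √(c / Real.pi) = t at *
  have key : √2 * x ≤ r + (√2 - 1) * t := by
    apply le_of_sq_le_sq _ (by nlinarith)
    have := mul_nonneg (mul_nonneg (sub_nonneg.2 h1.le) ht0) (sub_nonneg.2 htr)
    nlinarith
  nlinarith [mul_le_mul_of_nonneg_left key (by positivity : 0 ≤ 2 + √2)]

lemma legLength_add_le {a b : ℝ} (ha : 0 ≤ a) (hb : 0 ≤ b) :
    legLength a + legLength b ≤ √2 * legLength (a + b) := by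
  have h2 : √2 ^ 2 = 2 := Real.sq_sqrt zero_le_two
  have hπ := Real.pi_pos
  unfold legLength
  have hr := Real.sq_sqrt (show 0 ≤ (a + b) / Real.pi by positivity)
  have hr1 := Real.sq_sqrt (show 0 ≤ a / Real.pi by positivity)
  have hr2 := Real.sq_sqrt (show 0 ≤ b / Real.pi by positivity)
  rw [add_div, ← hr1, ← hr2, hr1, hr2, ← add_div] at hr
  have key : √(a / Real.pi) + √(b / Real.pi) ≤ √2 * √((a + b) / Real.pi) := by
    apply le_of_sq_le_sq _ (by positivity)
    rw [mul_pow, h2, hr, add_div, ← hr1, ← hr2, Real.sqrt_sq, Real.sqrt_sq]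
    · nlinarith [sq_nonneg (√(a / Real.pi) - √(b / Real.pi))]
    all_goals positivity
  nlinarith [mul_le_mul_of_nonneg_left key (by positivity : 0 ≤ 2 + √2)]

lemma exists_packing_in_triangle (C : Multiset ℝ) (hpos : ∀ c ∈ C, 0 < c) :
    ∃ l : List (ℝ × Plane), (↑(l.map Prod.fst) : Multiset ℝ) = C ∧
      (∀ p ∈ l, DiskInTriangle (legLength C.sum) √(p.1 / Real.pi) p.2) ∧
      l.Pairwise fun p q => √(p.1 / Real.pi) + √(q.1 / Real.pi) ≤ dist p.2 q.2 := by
  induction C using Multiset.strongInductionOn with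
  | ih C ih =>
  rcases C.empty_or_exists_mem with rfl | ⟨c, hc⟩
  · exact ⟨[], by simp⟩
  obtain ⟨D, rfl⟩ := Multiset.exists_cons_of_mem hc
  rcases D.empty_or_exists_mem with rfl | ⟨d, hd⟩
  · refine ⟨[(c, pt √(c / Real.pi) √(c / Real.pi))], by simp, ?_, by simp⟩
    simp only [List.mem_singleton, forall_eq, DiskInTriangle, pt_zero, pt_one, legLength,
      Multiset.sum_cons, Multiset.sum_zero, add_zero, le_refl, true_and]
    linarith
  obtain ⟨A, B, hAB, hA, hB⟩ := exists_balanced_split _ hpos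
  have hcard : 2 ≤ (A + B).card := by
    rw [hAB, Multiset.card_cons]
    have := Multiset.card_pos_iff_exists_mem.2 ⟨d, hd⟩
    omega
  generalize c ::ₘ D = E at *
  subst hAB
  have one_lt_card_false : ∀ F : Multiset ℝ, (∀ x ∈ F, 0 < x) → (∀ x ∈ F, F.sum ≤ x) →
      ¬ 2 ≤ F.card := by
    intro F hF h hF2
    obtain ⟨x, hx⟩ := Multiset.card_pos_iff_exists_mem.1 (by omega : 0 < F.card)
    obtain ⟨G, rfl⟩ := Multiset.exists_cons_of_mem hx
    rw [Multiset.card_cons] at hF2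
    obtain ⟨y, hy⟩ := Multiset.card_pos_iff_exists_mem.1 (by omega : 0 < G.card)
    have h1 := h x hx
    have h2 := Multiset.single_le_sum (fun z hz => (hF z (Multiset.mem_cons_of_mem hz)).le) y hy
    have h3 := hF y (Multiset.mem_cons_of_mem hy)
    rw [Multiset.sum_cons] at h1
    linarith
  have hA0 : A ≠ 0 := by
    rintro rfl
    exact one_lt_card_false B (by simpa using hpos) (by simpa using hB) (by simpa using hcard)
  have hB0 : B ≠ 0 := by
    rintro rfl
    exact one_lt_card_false A (by simpa using hpos) (by simpa using hA) (by simpa using hcard)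
  have hposA : ∀ x ∈ A, 0 < x := fun x hx => hpos x (Multiset.mem_add.2 (Or.inl hx))
  have hposB : ∀ x ∈ B, 0 < x := fun x hx => hpos x (Multiset.mem_add.2 (Or.inr hx))
  have hsA : 0 ≤ A.sum := Multiset.sum_nonneg fun x hx => (hposA x hx).le
  have hsB : 0 ≤ B.sum := Multiset.sum_nonneg fun x hx => (hposB x hx).le
  obtain ⟨k, hk, hkT, hkd⟩ := ih A (lt_add_of_pos_right A (pos_iff_ne_zero.2 hB0)) hposA
  obtain ⟨l, hl, hlT, hld⟩ := ih B (lt_add_of_pos_left B (pos_iff_ne_zero.2 hA0)) hposB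
  have hkA : ∀ p ∈ k, p.1 ∈ A := fun p hp => by
    rw [← hk]; exact Multiset.mem_coe.2 (List.mem_map_of_mem hp)
  have hlB : ∀ p ∈ l, p.1 ∈ B := fun p hp => by
    rw [← hl]; exact Multiset.mem_coe.2 (List.mem_map_of_mem hp)
  refine ⟨k.map (Prod.map id (toRightCorner (legLength (A + B).sum) (legLength A.sum))) ++
    l.map (Prod.map id (toTopCorner (legLength (A + B).sum) (legLength B.sum))), ?_, ?_, ?_⟩
  · rw [← hk, ← hl]
    simp [Function.comp_def]
  · intro p hp
    rw [Multiset.sum_add] at hp ⊢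
    rcases List.mem_append.1 hp with hp | hp <;> obtain ⟨q, hq, rfl⟩ := List.mem_map.1 hp
    · have hx := hkA q hq
      have := Multiset.single_le_sum (fun z hz => (hposA z hz).le) _ hx
      exact (hkT q hq).toRightCorner
        (sqrt_two_mul_legLength_le hsA hsB (hposA _ hx).le (by linarith) (hA _ hx))
    · have hx := hlB q hq
      have := Multiset.single_le_sum (fun z hz => (hposB z hz).le) _ hx
      rw [add_comm A.sum]
      exact (hlT q hq).toTopCorner
        (sqrt_two_mul_legLength_le hsB hsA (hposB _ hx).le (by linarith) (hB _ hx))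
  · rw [List.pairwise_append, List.pairwise_map, List.pairwise_map]
    refine ⟨hkd.imp ?_, hld.imp ?_, ?_⟩
    · intro p q h
      simpa [dist_toRightCorner] using h
    · intro p q h
      simpa [dist_toTopCorner] using h
    · intro p hp q hq
      obtain ⟨p, hpk, rfl⟩ := List.mem_map.1 hp
      obtain ⟨q, hql, rfl⟩ := List.mem_map.1 hq
      rw [Multiset.sum_add]
      exact le_dist_toRightCorner_toTopCorner (Real.sqrt_nonneg _) (Real.sqrt_nonneg _)
        (hkT p hpk) (hlT q hql) (legLength_add_le hsA hsB)

/-- Right isosceles `(a,b)`-hats are `𝔺(a,b)`-shapes: every finite multiset of positive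
reals with sum at most `a` and all elements at least `b` can be packed into the hat. -/
theorem right_iso_hat_is_CShape (a b : ℝ) (hb : 0 ≤ b) (hba : b ≤ a)
    (C : Multiset ℝ) (hpos : ∀ c ∈ C, 0 < c) (hsum : C.sum ≤ a)
    (hmin : ∀ c ∈ C, b ≤ c) :
    Packs C (rightIsoHat a b) := by
  obtain ⟨l, hl, hT, hd⟩ := exists_packing_in_triangle C hpos
  refine ⟨l, hl, fun p hp => ?_, hd.imp fun h => Metric.ball_disjoint_ball h⟩
  have hpC : p.1 ∈ C := by
    rw [← hl]; exact Multiset.mem_coe.2 (List.mem_map_of_mem hp)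
  have hmono := legLength_mono hsum
  obtain ⟨h0, h1, h2⟩ := hT p hp
  refine closedBall_subset_roundCorners (Real.sqrt_nonneg _) ?_
    (DiskInTriangle.closedBall_subset ⟨h0, h1, h2.trans (sub_le_sub_right hmono _)⟩)
  have := hmin _ hpC
  have := Real.pi_pos
  gcongr
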